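/- Let S be an order in an étale ℚ-algebra K, let T be an over-order of S such that S^t·T is invertible in T, and let 𝔣 be an ideal of S (a fractional S-ideal contained in S) such that T ⊆ (𝔣:𝔣). Then every fractional S-ideal I' with multiplicator ring (I':I') = S is weakly equivalent to a fractional S-ideal I satisfying 𝔣 ⊆ I ⊆ T. -/

import Mathlib

/-!
Setting: `K` is an étale `ℚ`-algebra (a commutative `ℚ`-algebra, reduced and
finite-dimensional over `ℚ`), and `R` is an order in `K`: a subring of `K`
(equivalently a `ℤ`-subalgebra) that is finitely generated as a `ℤ`-module and
spans `K` over `ℚ`.  A fractional `R`-ideal is a finitely generated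
`R`-submodule of `K` spanning `K` over `ℚ`.
-/

open Submodule

variable {K : Type*} [CommRing K] [Algebra ℚ K]
variable {R : Subalgebra ℤ K}

/-- The ideal quotient `(I : J) = {x ∈ K | x·J ⊆ I}`. -/
def colonSub (I J : Submodule ↥R K) : Submodule ↥R K where
  carrier := {x : K | ∀ y ∈ J, x * y ∈ I}
  zero_mem' := fun y _ => by simp [I.zero_mem]
  add_mem' := fun {a b} ha hb y hy => by
    simpa [add_mul] using I.add_mem (ha y hy) (hb y hy)
  smul_mem' := fun c x hx y hy => by
    simpa [smul_mul_assoc] using I.smul_mem c (hx y hy)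

/-- The trace dual `I^t = {x ∈ K | Tr_{K/ℚ}(x·I) ⊆ ℤ}`, where `Tr_{K/ℚ}(z)` is the
trace of the `ℚ`-linear endomorphism `y ↦ z·y` of `K`. -/
def traceDualSub (I : Submodule ↥R K) : Submodule ↥R K where
  carrier := {x : K | ∀ y ∈ I, ∃ n : ℤ, Algebra.trace ℚ K (x * y) = (n : ℚ)}
  zero_mem' := fun y _ => ⟨0, by simp⟩
  add_mem' := fun {a b} ha hb y hy => by
    obtain ⟨n, hn⟩ := ha y hy
    obtain ⟨m, hm⟩ := hb y hy
    refine ⟨n + m, ?_⟩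
    rw [add_mul, map_add, hn, hm]
    push_cast
    ring
  smul_mem' := fun c x hx y hy => by
    obtain ⟨n, hn⟩ := hx (c • y) (I.smul_mem c hy)
    refine ⟨n, ?_⟩
    rw [← hn]
    congr 1
    rw [Algebra.smul_def, Algebra.smul_def]
    ring


theorem aux_nondeg [FiniteDimensional ℚ K] [IsReduced K] :
    (Algebra.traceForm ℚ K).Nondegenerate := by
  have key : ∀ x : K, (∀ y, Algebra.trace ℚ K (x * y) = 0) → x = 0 := by
    intro x hx
    have : IsArtinianRing K := IsArtinianRing.of_finite ℚ K
    obtain ⟨n, y, hy⟩ := IsArtinian.exists_pow_succ_smul_dvd x (1 : K)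
    have h1 : x * (1 - x * y) = 0 := by
      apply eq_zero_of_pow_eq_zero (n := n + 1)
      rw [mul_pow, pow_succ (1 - x * y)]
      simp only [smul_eq_mul, Nat.succ_eq_add_one, mul_one] at hy
      have h2 : x ^ n * (1 - x * y) = 0 := by
        rw [mul_sub, ← mul_assoc, ← pow_succ, hy]; ring
      calc _ = x * (1 - x * y) ^ n * (x ^ n * (1 - x * y)) := by ring
        _ = 0 := by rw [h2, mul_zero]
    have hid : IsIdempotentElem (Algebra.lmul ℚ K (x * y)) := by
      rw [IsIdempotentElem, ← map_mul]
      congr 1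
      linear_combination (-y) * h1
    have h0 : LinearMap.trace ℚ K (Algebra.lmul ℚ K (x * y)) = 0 := hx y
    have he := LinearMap.IsIdempotentElem.eq_zero_of_trace_eq_zero hid h0
    have he2 : x * y = 0 := by simpa using congrArg (fun f => f 1) he
    rw [he2] at h1
    simpa using h1
  rw [LinearMap.BilinForm.nondegenerate_iff_ker_eq_bot, LinearMap.ker_eq_bot']
  intro x hx
  exact key x fun y => by simpa using congrArg (fun f => f y) hx

theorem aux_basis [FiniteDimensional ℚ K] (M : Submodule ℤ K) (hfg : M.FG)
    (hs : Submodule.span ℚ (M : Set K) = ⊤) :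
    ∃ (n : ℕ) (b : Module.Basis (Fin n) ℚ K), M = Submodule.span ℤ (Set.range b) := by
  have : IsLattice ℚ M := ⟨hfg, hs⟩
  have : Module.Finite ℤ M := Module.Finite.iff_fg.2 hfg
  have hfree : Module.Free ℤ M := IsLattice.free ℚ M
  let b := Module.finBasis ℤ M
  refine ⟨_, b.extendOfIsLattice ℚ, ?_⟩
  have := b.span_eq
  have h2 : (Set.range (b.extendOfIsLattice ℚ)) = M.subtype '' (Set.range b) := by
    ext; simp
  rw [h2, ← Submodule.map_span, this]; simp

theorem aux_mem_int [FiniteDimensional ℚ K] (M : Submodule R K)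
    (hs : Submodule.span ℚ (M : Set K) = ⊤) : ∃ n : ℤ, n ≠ 0 ∧ (n : K) ∈ M := by
  have h : (1 : K) ∈ Submodule.span ℚ (M : Set K) := by rw [hs]; trivial
  have key : ∀ z ∈ Submodule.span ℚ (M : Set K), ∃ n : ℤ, n ≠ 0 ∧ (n : K) * z ∈ M := by
    intro z hz
    induction hz using Submodule.span_induction with
    | mem x hx => exact ⟨1, one_ne_zero, by simpa using hx⟩
    | zero => exact ⟨1, one_ne_zero, by simp⟩
    | add x y _ _ hx hy =>
      obtain ⟨n, hn, hx⟩ := hx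
      obtain ⟨m, hm, hy⟩ := hy
      refine ⟨n * m, mul_ne_zero hn hm, ?_⟩
      have h1 := M.toAddSubgroup.zsmul_mem hx m
      have h2 := M.toAddSubgroup.zsmul_mem hy n
      have h3 := M.add_mem h1 h2
      convert h3 using 1
      simp only [zsmul_eq_mul]; push_cast; ring
    | smul a x _ hx =>
      obtain ⟨n, hn, hx⟩ := hx
      refine ⟨n * a.den, mul_ne_zero hn (by exact_mod_cast a.den_ne_zero), ?_⟩
      have h1 : a.num • ((n : K) * x) ∈ M := M.toAddSubgroup.zsmul_mem hx a.num
      convert h1 using 1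
      have : ((a.den : ℕ) : K) * algebraMap ℚ K a = (a.num : K) := by
        have := congrArg (algebraMap ℚ K) (Rat.den_mul_eq_num a)
        rwa [map_mul, map_natCast, map_intCast] at this
      rw [zsmul_eq_mul, Algebra.smul_def]; push_cast
      linear_combination (n : K) * x * this
  obtain ⟨n, hn, h⟩ := key 1 h
  exact ⟨n, hn, by simpa using h⟩

theorem aux_dual_eq (M : Submodule R K) :
    (traceDualSub M).restrictScalars ℤ =
      (Algebra.traceForm ℚ K).dualSubmodule (M.restrictScalars ℤ) := by
  ext x
  rw [LinearMap.BilinForm.mem_dualSubmodule]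
  refine forall₂_congr fun y hy => ?_
  rw [Submodule.mem_one]
  simp [Algebra.traceForm_apply, eq_comm]

theorem aux_fgZ (hRfin : Module.Finite ℤ R) (M : Submodule R K) (h : M.FG) :
    (M.restrictScalars ℤ).FG := by
  have : Module.Finite R M := Module.Finite.iff_fg.2 h
  have : Module.Finite ℤ M := Module.Finite.trans R M
  exact Module.Finite.iff_fg.1 (inferInstanceAs (Module.Finite ℤ M))

theorem aux_dual [FiniteDimensional ℚ K] [IsReduced K] (hRfin : Module.Finite ℤ R)
    (M : Submodule R K) (hfg : M.FG) (hs : Submodule.span ℚ (M : Set K) = ⊤) :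
    (traceDualSub M).FG ∧ Submodule.span ℚ (traceDualSub M : Set K) = ⊤ ∧
      traceDualSub (traceDualSub M) = M := by
  obtain ⟨n, b, hb⟩ := aux_basis (M.restrictScalars ℤ) (aux_fgZ hRfin M hfg) hs
  have h1 := aux_dual_eq M
  have h2 := aux_dual_eq (traceDualSub M)
  rw [h1] at h2
  rw [hb] at h2 h1
  rw [LinearMap.BilinForm.dualSubmodule_dualSubmodule_of_basis _ aux_nondeg
    (Algebra.traceForm_isSymm ℚ), ← hb] at h2
  rw [LinearMap.BilinForm.dualSubmodule_span_of_basis _ aux_nondeg] at h1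
  refine ⟨?_, ?_, Submodule.restrictScalars_injective ℤ _ _ h2⟩
  · apply Submodule.FG.of_restrictScalars ℤ
    rw [h1]
    exact Submodule.fg_span (Set.finite_range _)
  · have h3 : (traceDualSub M : Set K) = ((traceDualSub M).restrictScalars ℤ : Set K) := rfl
    rw [h3, h1, eq_top_iff, ← Module.Basis.span_eq
      ((Algebra.traceForm ℚ K).dualBasis aux_nondeg b)]
    exact Submodule.span_mono Submodule.subset_span

theorem aux_mul_dual [FiniteDimensional ℚ K] [IsReduced K] (hRfin : Module.Finite ℤ R)
    (M : Submodule R K) (hfg : M.FG) (hs : Submodule.span ℚ (M : Set K) = ⊤)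
    (hM : colonSub M M = 1) : M * traceDualSub M = traceDualSub 1 := by
  obtain ⟨d1, d2, d3⟩ := aux_dual hRfin M hfg hs
  have hP1 : (M * traceDualSub M).FG := hfg.mul d1
  have hP2 : Submodule.span ℚ ((M * traceDualSub M : Submodule R K) : Set K) = ⊤ := by
    obtain ⟨n, hn, hnM⟩ := aux_mem_int M hs
    rw [eq_top_iff, ← d2, Submodule.span_le]
    intro y hy
    have h := Submodule.subset_span (R := ℚ) (Submodule.mul_mem_mul hnM hy : _ ∈ (M * traceDualSub M))
    have h' := Submodule.smul_mem _ ((n : ℚ)⁻¹) h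
    convert h' using 1
    rw [← smul_mul_assoc]
    have : ((n : ℚ)⁻¹) • (n : K) = 1 := by
      rw [Algebra.smul_def, ← map_intCast (algebraMap ℚ K) n, ← map_mul, inv_mul_cancel₀ (by exact_mod_cast hn), map_one]
    rw [this, one_mul]
    rfl
  obtain ⟨-, -, p3⟩ := aux_dual hRfin _ hP1 hP2
  have : traceDualSub (M * traceDualSub M) = 1 := by
    rw [← hM]
    apply le_antisymm
    · intro x hx m hm
      rw [← d3]
      intro y hy
      rw [mul_assoc]
      exact hx _ (Submodule.mul_mem_mul hm hy)
    · intro x hx y hy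
      induction hy using Submodule.mul_induction_on' with
      | mem_mul_mem m hm n hn =>
        have := hn _ (hx m hm)
        rwa [mul_comm n, mul_assoc] at this
      | add a _ b _ ha hb =>
        obtain ⟨u, hu⟩ := ha
        obtain ⟨v, hv⟩ := hb
        exact ⟨u + v, by rw [mul_add, map_add, hu, hv]; push_cast; rfl⟩
  rw [← this, p3]

theorem aux_crt {B L : Type*} [CommRing B] [CommRing L] [Algebra B L]
    (hinj : Function.Injective (algebraMap B L)) (A : Ideal B) [Finite (B ⧸ A)]
    (J N : Submodule B L) (hJN : J * N = 1) :
    ∃ x ∈ J, ∃ n ∈ N, ∃ a ∈ A, x * n + algebraMap B L a = 1 := by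
  classical
  have hf : {M : Ideal B | M.IsMaximal ∧ A ≤ M}.Finite := by
    have : Finite (Ideal (B ⧸ A)) := Finite.of_injective
      (fun I => (I : Set (B ⧸ A))) SetLike.coe_injective
    refine Set.Finite.subset (Set.finite_range
      (fun I : Ideal (B ⧸ A) => I.comap (Ideal.Quotient.mk A))) ?_
    rintro M ⟨-, hM⟩
    refine ⟨M.map (Ideal.Quotient.mk A), ?_⟩
    simp [Ideal.comap_map_of_surjective _ Ideal.Quotient.mk_surjective,
      ← RingHom.ker_eq_comap_bot, hM]
  let s := hf.toFinset
  have hs : ∀ M, M ∈ s ↔ M.IsMaximal ∧ A ≤ M := fun M => hf.mem_toFinset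
  have coprime : ∀ M ∈ s, ∀ M' ∈ s.erase M, M ⊔ M' = ⊤ := by
    intro M hM M' hM'
    rw [Finset.mem_erase] at hM'
    exact Ideal.IsMaximal.coprime_of_ne ((hs _).1 hM).1 ((hs _).1 hM'.2).1 hM'.1.symm
  have nle : ∀ M ∈ s, ¬⨅ M' ∈ s.erase M, M' ≤ M := fun M hM =>
    left_lt_sup.1
      (((hs _).1 hM).1.lt_top.trans_eq (Ideal.sup_iInf_eq_top <| coprime M hM).symm)
  have hc : ∀ a ∈ J, ∀ b ∈ N, ∃ c : B, algebraMap B L c = a * b := by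
    intro a ha b hb
    have := Submodule.mul_mem_mul ha hb
    rw [hJN] at this
    exact Submodule.mem_one.1 this
  have hex : ∀ M ∈ s, ∃ a ∈ J, ∃ b ∈ N, ∀ c, algebraMap B L c = a * b → c ∉ M := by
    intro M hM
    by_contra! h
    have hle : J * N ≤ Submodule.map (Algebra.linearMap B L) M := by
      rw [Submodule.mul_le]
      intro a ha b hb
      obtain ⟨c, hc, hcM⟩ := h a ha b hb
      exact ⟨c, hcM, hc⟩
    rw [hJN] at hle
    obtain ⟨c, hcM, hc1⟩ := hle (Submodule.one_le.1 le_rfl)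
    have : c = 1 := hinj (by simpa using hc1)
    exact ((hs _).1 hM).1.ne_top ((Ideal.eq_top_iff_one _).2 (this ▸ hcM))
  choose! a ha b hb hm using hex
  choose! u hu hum using fun M hM => SetLike.not_le_iff_exists.1 (nle M hM)
  let v := ∑ M ∈ s, u M • a M
  have hv : v ∈ J := Submodule.sum_mem _ fun M hM => Submodule.smul_mem _ _ <| ha M hM
  let Q : Ideal B := Submodule.comap (Algebra.linearMap B L) (Submodule.span B {v} * N) ⊔ A
  have hQ : Q = ⊤ := by
    by_contra h
    obtain ⟨M, hMmax, hQM⟩ := Ideal.exists_le_maximal _ h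
    have hM : M ∈ s := (hs _).2 ⟨hMmax, le_sup_right.trans hQM⟩
    choose! c hcc using fun M' (hM' : M' ∈ s) => hc (a M') (ha M' hM') (b M) (hb M hM)
    have hsum : algebraMap B L (∑ M' ∈ s, u M' * c M') = v * b M := by
      rw [map_sum, Finset.sum_mul]
      refine Finset.sum_congr rfl fun M' hM' => ?_
      rw [map_mul, hcc M' hM', Algebra.smul_def, mul_assoc]
    have hin : (∑ M' ∈ s, u M' * c M') ∈ M := by
      apply hQM
      apply Submodule.mem_sup_left
      rw [Submodule.mem_comap, Algebra.linearMap_apply, hsum]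
      exact Submodule.mul_mem_mul (Submodule.mem_span_singleton_self v) (hb M hM)
    rw [← s.add_sum_erase _ hM, Submodule.add_mem_iff_left] at hin
    · rcases hMmax.isPrime.mem_or_mem hin with h1 | h1
      · exact hum M hM h1
      · exact hm M hM _ (hcc M hM) h1
    · refine Submodule.sum_mem _ fun M' hM' => ?_
      rw [Finset.mem_erase] at hM'
      apply Ideal.mul_mem_right
      have := hu M' hM'.2
      simp only [Submodule.mem_iInf] at this
      exact this M (Finset.mem_erase.2 ⟨hM'.1.symm, hM⟩)
  have h1 : (1 : B) ∈ Q := by rw [hQ]; trivial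
  obtain ⟨p, hp, q, hq, hpq⟩ := Submodule.mem_sup.1 h1
  obtain ⟨n, hn, hvn⟩ := Submodule.mem_span_singleton_mul.1 hp
  refine ⟨v, hv, n, hn, q, hq, ?_⟩
  rw [hvn, Algebra.linearMap_apply, ← map_add, hpq, map_one]

theorem aux_exists (hRfin : Module.Finite ℤ R) [FiniteDimensional ℚ K]
    (T : Submodule R K) (hTfg : T.FG) (hTone : (1 : K) ∈ T) (hTmul : T * T ≤ T)
    (𝔣 : Submodule R K) (h𝔣span : Submodule.span ℚ (𝔣 : Set K) = ⊤)
    (hT𝔣 : T * 𝔣 ≤ 𝔣) (J N : Submodule R K)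
    (hJ : T * J ≤ J) (hN : T * N ≤ N) (hJN : J * N = T) :
    ∃ x ∈ J, ∃ n ∈ N, ∃ a ∈ 𝔣, x * n + 2 * a = 1 := by
  let B : Subalgebra ℤ K :=
    { carrier := T
      mul_mem' := fun ha hb => hTmul (Submodule.mul_mem_mul ha hb)
      one_mem' := hTone
      zero_mem' := T.zero_mem
      add_mem' := T.add_mem
      algebraMap_mem' := fun n => by
        have := T.toAddSubgroup.zsmul_mem hTone n
        simpa using this }
  let up : ∀ M : Submodule R K, T * M ≤ M → Submodule B K := fun M hM =>
    { carrier := M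
      zero_mem' := M.zero_mem
      add_mem' := M.add_mem
      smul_mem' := fun c x hx => hM (Submodule.mul_mem_mul c.2 hx) }
  let A : Ideal B :=
    { carrier := {t | ∃ a ∈ 𝔣, (t : K) = 2 * a}
      zero_mem' := ⟨0, 𝔣.zero_mem, by simp⟩
      add_mem' := by
        rintro s t ⟨a, ha, hs⟩ ⟨b, hb, ht⟩
        exact ⟨a + b, 𝔣.add_mem ha hb, by push_cast; rw [hs, ht]; ring⟩
      smul_mem' := by
        rintro c t ⟨a, ha, ht⟩
        exact ⟨c * a, hT𝔣 (Submodule.mul_mem_mul c.2 ha), by simp [ht]; ring⟩ }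
  have hBfin : Module.Finite ℤ B := by
    have h := aux_fgZ hRfin T hTfg
    have : (Subalgebra.toSubmodule B) = T.restrictScalars ℤ := by ext; rfl
    rw [← this] at h
    exact Module.Finite.iff_fg.2 h
  have hfin : Finite (B ⧸ A) := by
    have : Module.Finite ℤ (B ⧸ A) := Module.Finite.of_surjective
      ((Ideal.Quotient.mk A).toAddMonoidHom.toIntLinearMap) Ideal.Quotient.mk_surjective
    apply Module.finite_of_fg_torsion
    obtain ⟨m, hm, hm𝔣⟩ := aux_mem_int 𝔣 h𝔣span
    intro z
    refine ⟨⟨2 * m, mem_nonZeroDivisors_of_ne_zero (by simpa using hm)⟩, ?_⟩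
    obtain ⟨z, rfl⟩ := Ideal.Quotient.mk_surjective z
    change (2 * m) • (Ideal.Quotient.mk A z) = 0
    rw [← map_zsmul, Ideal.Quotient.eq_zero_iff_mem]
    refine ⟨z * m, hT𝔣 (Submodule.mul_mem_mul z.2 hm𝔣), ?_⟩
    push_cast
    rw [zsmul_eq_mul]; push_cast; ring
  have hmul : up J hJ * up N hN = 1 := by
    apply le_antisymm
    · rw [Submodule.mul_le]
      intro a ha b hb
      rw [Submodule.mem_one]
      have : a * b ∈ T := hJN ▸ Submodule.mul_mem_mul (M := J) (N := N) ha hb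
      exact ⟨⟨a * b, this⟩, rfl⟩
    · rw [Submodule.one_le]
      have h1 : (1 : K) ∈ J * N := hJN ▸ hTone
      refine Submodule.mul_induction_on (C := fun z => z ∈ up J hJ * up N hN) h1 ?_ ?_
      · intro a ha b hb
        exact Submodule.mul_mem_mul (M := up J hJ) (N := up N hN) ha hb
      · intro a b ha hb
        exact Submodule.add_mem _ ha hb
  obtain ⟨x, hx, n, hn, a, ⟨a', ha', haa⟩, h⟩ :=
    aux_crt (B := B) (L := K) Subtype.val_injective A (up J hJ) (up N hN) hmul
  exact ⟨x, hx, n, hn, a', ha', by rw [← haa]; exact h⟩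

theorem aux_unit [FiniteDimensional ℚ K] (hRfin : Module.Finite ℤ R) (x n a : K)
    (ha : a ∈ (1 : Submodule R K)) (h : x * n + 2 * a = 1) : IsUnit x := by
  have : IsArtinianRing K := IsArtinianRing.of_finite ℚ K
  apply IsArtinianRing.isUnit_of_mem_nonZeroDivisors
  rw [mem_nonZeroDivisors_iff_right]
  intro w hw
  by_contra hw0
  obtain ⟨r, rfl⟩ := Submodule.mem_one.1 ha
  have hint : IsIntegral ℤ (algebraMap R K r) :=
    (Algebra.IsIntegral.isIntegral (R := ℤ) r).map (IsScalarTower.toAlgHom ℤ R K)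
  obtain ⟨p, hp, hp0⟩ := hint
  have hwa : (algebraMap R K r) * w = ((1 : ℚ) / 2) • w := by
    have h2 : (2 : K) * ((algebraMap R K r) * w) = w := by
      linear_combination w * h - n * hw
    have h2' : (2 : ℚ) • ((algebraMap R K r) * w) = w := by rw [two_smul, ← two_mul, h2]
    conv_rhs => rw [← h2']
    rw [smul_smul]; norm_num
  have hev : Module.End.HasEigenvector (Algebra.lmul ℚ K (algebraMap R K r)) (1 / 2) w :=
    ⟨Module.End.mem_eigenspace_iff.2 hwa, hw0⟩
  have h3 := Module.End.aeval_apply_of_hasEigenvector (p := p.map (algebraMap ℤ ℚ)) hev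
  have h4 : Polynomial.aeval (Algebra.lmul ℚ K (algebraMap R K r))
      (p.map (algebraMap ℤ ℚ)) = 0 := by
    rw [Polynomial.aeval_algHom_apply]
    rw [Polynomial.aeval_map_algebraMap]
    have : Polynomial.aeval (algebraMap R K r) p = 0 := hp0
    rw [this, map_zero]
  rw [h4, LinearMap.zero_apply, eq_comm, smul_eq_zero, or_iff_left hw0] at h3
  have h5 : IsIntegral ℤ ((1 : ℚ) / 2) := ⟨p, hp, by
    rw [Polynomial.eval_map] at h3; exact h3⟩
  obtain ⟨k, hk⟩ := IsIntegrallyClosed.isIntegral_iff.1 h5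
  have : ((2 * k : ℤ) : ℚ) = 1 := by push_cast; rw [show (k : ℚ) = 1 / 2 from hk]; norm_num
  have : 2 * k = 1 := by exact_mod_cast this
  omega

theorem aux_le_colon (A I J : Submodule R K) : A ≤ colonSub I J ↔ A * J ≤ I := by
  rw [Submodule.mul_le]; rfl

/-- Let `S` be an order in an étale `ℚ`-algebra `K` (here named `R`),
let `T` be an over-order of `S` (a fractional `S`-ideal that is a subring of `K`)
such that `S^t·T` is invertible in `T` (i.e. `(S^t·T)·(T:S^t·T) = T`), and let `𝔣` be
an ideal of `S` (a fractional `S`-ideal contained in `S`) such that `T ⊆ (𝔣:𝔣)`.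
Then every fractional `S`-ideal `I'` with multiplicator ring `(I':I') = S` is weakly
equivalent to a fractional `S`-ideal `I` satisfying `𝔣 ⊆ I ⊆ T`. -/
theorem weak_class_representative_between_conductor_and_overorder
    [FiniteDimensional ℚ K] [IsReduced K]
    (hRfin : Module.Finite ℤ R) (hRspan : Submodule.span ℚ (R : Set K) = ⊤)
    (T : Submodule ↥R K) (hTfg : T.FG) (hTspan : Submodule.span ℚ (T : Set K) = ⊤)
    (hTone : (1 : K) ∈ T) (hTmul : T * T ≤ T)
    (hTinv : (traceDualSub 1 * T) * colonSub T (traceDualSub 1 * T) = T)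
    (𝔣 : Submodule ↥R K) (h𝔣fg : 𝔣.FG) (h𝔣span : Submodule.span ℚ (𝔣 : Set K) = ⊤)
    (h𝔣sub : 𝔣 ≤ 1) (hT𝔣 : T ≤ colonSub 𝔣 𝔣) :
    ∀ I' : Submodule ↥R K, I'.FG → Submodule.span ℚ (I' : Set K) = ⊤ →
      colonSub I' I' = 1 →
      ∃ I : Submodule ↥R K, I.FG ∧ Submodule.span ℚ (I : Set K) = ⊤ ∧
        (1 : K) ∈ colonSub I' I * colonSub I I' ∧ 𝔣 ≤ I ∧ I ≤ T := by
  intro I' hfg hs hcol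
  have hone : (1 : Submodule R K) ≤ T := Submodule.one_le.2 hTone
  have hTT : T * T = T := le_antisymm hTmul (by simpa using mul_le_mul' hone (le_refl T))
  have hTf : T * 𝔣 ≤ 𝔣 := (aux_le_colon _ _ _).1 hT𝔣
  have hmd := aux_mul_dual hRfin I' hfg hs hcol
  obtain ⟨J, hTJ, hJ⟩ : ∃ J : Submodule R K, T * J = J ∧ I' * J = T := by
    refine ⟨traceDualSub I' * T * colonSub T (traceDualSub 1 * T), ?_, ?_⟩
    · rw [← mul_assoc, mul_left_comm, hTT]
    · rw [← mul_assoc, ← mul_assoc, hmd, hTinv]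
  obtain ⟨x, hx, n, hn, a, ha, hxna⟩ := aux_exists hRfin T hTfg hTone hTmul 𝔣 h𝔣span hTf
    J (T * I') hTJ.le (by rw [← mul_assoc, hTT]) (by
      rw [mul_left_comm, mul_comm J, hJ, hTT])
  have hxu : IsUnit x := aux_unit hRfin x n a (h𝔣sub ha) hxna
  obtain ⟨y, hxy⟩ := hxu.exists_right_inv
  have hXJ : Submodule.span R {x} ≤ J := by
    rw [Submodule.span_singleton_le_iff_mem]; exact hx
  have hff : 𝔣 ≤ Submodule.span R {x} * (I' * 𝔣) ⊔ 𝔣 * 𝔣 := by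
    intro g hg
    have e : g = x * (n * g) + (a + a) * g := by linear_combination (-g) * hxna
    rw [e]
    refine Submodule.add_mem_sup (Submodule.mul_mem_mul (Submodule.mem_span_singleton_self x) ?_)
      (Submodule.mul_mem_mul (𝔣.add_mem ha ha) hg)
    have h1 : n * g ∈ T * I' * 𝔣 := Submodule.mul_mem_mul hn hg
    have h2 : T * I' * 𝔣 ≤ I' * 𝔣 := by
      rw [mul_comm T, mul_assoc]; exact mul_le_mul' le_rfl hTf
    exact h2 h1
  obtain ⟨r, hr, hrf⟩ := Submodule.exists_sub_one_mem_and_smul_le_of_fg_of_le_sup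
    (I := Submodule.comap (Algebra.linearMap R K) 𝔣) (N := Submodule.span R {x} * (I' * 𝔣))
    h𝔣fg le_rfl (hff.trans (sup_le_sup_left (by
      rw [Submodule.mul_le]
      intro u hu v hv
      obtain ⟨c, rfl⟩ := Submodule.mem_one.1 (h𝔣sub hu)
      rw [← Algebra.smul_def]
      exact Submodule.smul_mem_smul hu hv) _))
  have hfI' : 𝔣 * I' ≤ I' := by simpa using mul_le_mul' h𝔣sub (le_refl I')
  have hIT : Submodule.span R {x} * I' ⊔ 𝔣 ≤ T := by
    refine sup_le ?_ (h𝔣sub.trans hone)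
    rw [← hJ, mul_comm I']
    exact mul_le_mul' hXJ le_rfl
  refine ⟨Submodule.span R {x} * I' ⊔ 𝔣, ?_, ?_, ?_, le_sup_right, hIT⟩
  · exact ((Submodule.fg_span_singleton x).mul hfg).sup h𝔣fg
  · rw [eq_top_iff, ← h𝔣span]
    exact Submodule.span_mono (le_sup_right : 𝔣 ≤ _)
  set I := Submodule.span R {x} * I' ⊔ 𝔣 with hI
  have c1 : Submodule.span R {x} ≤ colonSub I I' := (aux_le_colon _ _ _).2 le_sup_left
  have c2 : 𝔣 * J ≤ colonSub I I' := by
    rw [aux_le_colon, mul_assoc, mul_comm J, hJ, mul_comm]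
    exact hTf.trans le_sup_right
  have c3 : 𝔣 * I' ≤ colonSub I' I := by
    rw [aux_le_colon]
    calc 𝔣 * I' * I ≤ 𝔣 * I' * T := mul_le_mul' le_rfl hIT
      _ = T * 𝔣 * I' := by rw [mul_comm, mul_assoc]
      _ ≤ 𝔣 * I' := mul_le_mul' hTf le_rfl
      _ ≤ I' := hfI'
  have hfP : 𝔣 ≤ colonSub I' I * colonSub I I' := by
    refine hff.trans (sup_le ?_ ?_)
    · rw [mul_comm, mul_comm I']
      exact mul_le_mul' c3 c1
    · calc 𝔣 * 𝔣 = 𝔣 * 𝔣 * 1 := (mul_one _).symm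
        _ ≤ 𝔣 * 𝔣 * T := mul_le_mul' le_rfl hone
        _ = (𝔣 * I') * (𝔣 * J) := by rw [← hJ, mul_mul_mul_comm]
        _ ≤ _ := mul_le_mul' c3 c2
  have hz : (r : K) * y ∈ colonSub I' I := by
    intro w hw
    obtain ⟨p, hp, g, hg, rfl⟩ := Submodule.mem_sup.1 hw
    rw [mul_add]
    refine I'.add_mem ?_ ?_
    · obtain ⟨i, hi, rfl⟩ := Submodule.mem_span_singleton_mul.1 hp
      have : (r : K) * y * (x * i) = r • i := by
        rw [Algebra.smul_def]
        change _ = (r : K) * i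
        linear_combination (r : K) * i * hxy
      rw [this]; exact I'.smul_mem r hi
    · have h1 : r • g ∈ Submodule.span R {x} * (I' * 𝔣) :=
        hrf (Submodule.smul_mem_pointwise_smul _ _ _ hg)
      obtain ⟨i, hi, hxi⟩ := Submodule.mem_span_singleton_mul.1 h1
      have h2 : x * i = (r : K) * g := hxi
      have : (r : K) * y * g = i := by
        linear_combination i * hxy - y * h2
      rw [this]
      rw [mul_comm I'] at hi
      exact hfI' hi
  have hrP : (r : K) ∈ colonSub I' I * colonSub I I' := by
    have := Submodule.mul_mem_mul hz (c1 (Submodule.mem_span_singleton_self x))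
    convert this using 1
    linear_combination (-(r : K)) * hxy
  have hr1 : (r : K) - 1 ∈ 𝔣 := hr
  have := Submodule.sub_mem _ hrP (hfP hr1)
  simpa using this
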